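/- Let G=(N,E) and G'=(N,E') be DAGs on the same node set, with each state space X_s having at least two elements. Then P^{G'} ⊇ P^G if and only if for all subsets A,B,S ⊆ N, A ⊥_{G'} B | S implies A ⊥_G B | S. -/

import Mathlib

open Finset

/-! Basic graph-theoretic definitions for Bayesian networks. -/

/-- Two nodes are joined (adjacent) in the directed graph `E`. -/
def GJoined {V : Type*} (E : V → V → Prop) (a b : V) : Prop := E a b ∨ E b a

/-- A directed graph (given by its edge relation) is a DAG iff it has no cycles:
no node can reach itself by a nonempty directed walk. -/
def IsDAG {V : Type*} (E : V → V → Prop) : Prop := ∀ s, ¬ Relation.TransGen E s s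

/-- The set of parents of `s`. -/
def paG {V : Type*} (E : V → V → Prop) (s : V) : Set V := {t | E t s}

/-- The set of children of `s`. -/
def chG {V : Type*} (E : V → V → Prop) (s : V) : Set V := {t | E s t}

/-- The set of descendants of `s` (nodes reachable from `s` by a nonempty directed path). -/
def desG {V : Type*} (E : V → V → Prop) (s : V) : Set V := {t | Relation.TransGen E s t}

/-- A set of nodes is complete if all pairs of distinct elements are joined. -/
def GComplete {V : Type*} (E : V → V → Prop) (S : Set V) : Prop :=
  ∀ a ∈ S, ∀ b ∈ S, a ≠ b → GJoined E a b

/-- A directed graph is perfect if the parent set of every node is complete. -/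
def GPerfect {V : Type*} (E : V → V → Prop) : Prop := ∀ s, GComplete E (paG E s)

/-- `a` and `b` are joined in the moral graph `G^M` of `E`:
either joined in `E` or distinct common parents of some node. -/
def MoralEdge {V : Type*} (E : V → V → Prop) (a b : V) : Prop :=
  E a b ∨ E b a ∨ (a ≠ b ∧ ∃ s, E a s ∧ E b s)

/-- A topological ordering of a graph on a finite node set: an injective map into
`{1, …, |N|}` (encoded as `Fin (card V)`) increasing along edges. -/
def IsTopo {V : Type*} [Fintype V] (E : V → V → Prop) (O : V → Fin (Fintype.card V)) : Prop :=
  Function.Injective O ∧ ∀ s t, E s t → O s < O t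

/-! d-separation. -/

/-- `u` is a v-structure (collider) of the trail `l` in the graph `E`. -/
def VStruct {V : Type*} (E : V → V → Prop) (l : List V) (u : V) : Prop :=
  ∃ l₁ l₂ a b, l = l₁ ++ a :: u :: b :: l₂ ∧ E a u ∧ E b u

/-- `l` is a trail in the graph `E`: a nonempty sequence of distinct nodes consecutively joined. -/
def IsTrail {V : Type*} (E : V → V → Prop) (l : List V) : Prop :=
  l ≠ [] ∧ l.Nodup ∧ l.Chain' (GJoined E)

/-- The trail `l` is blocked by `S`. -/
def BlockedBy {V : Type*} (E : V → V → Prop) (S : Set V) (l : List V) : Prop :=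
  ∃ u ∈ l, (u ∈ S ∧ ¬ VStruct E l u) ∨
    (VStruct E l u ∧ u ∉ S ∧ ∀ t ∈ desG E u, t ∉ S)

/-- d-separation: every trail from a node of `A` to a node of `B` is blocked by `S`. -/
def DSep {V : Type*} (E : V → V → Prop) (A B S : Set V) : Prop :=
  ∀ (l : List V) (a b : V), IsTrail E l → l.head? = some a → l.getLast? = some b →
    a ∈ A → b ∈ B → BlockedBy E S l

/-- The set of leaves (childless nodes), as a `Finset`. -/
def leavesF {V : Type*} [Fintype V] (E : V → V → Prop) [DecidableRel E] : Finset V :=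
  Finset.univ.filter fun s => ∀ t, ¬ E s t

/-! Probability on graphs (finite state spaces, pmfs). -/

section Prob

variable {V : Type*} [Fintype V] [DecidableEq V]
variable (X : V → Type*) [∀ v, Fintype (X v)]

/-- `p` is a probability mass function on `X_N = ∏ v, X v`. -/
def IsPMF (p : (∀ v, X v) → ℝ) : Prop :=
  (∀ x, 0 ≤ p x) ∧ ∑ x, p x = 1

/-- `k` is a kernel function for the node `s` w.r.t. the graph `E`: it is nonnegative,
depends on the configuration only through the parents of `s` in `E`, and is normalized. -/
def IsKernel (E : V → V → Prop) (s : V) (k : X s → (∀ v, X v) → ℝ) : Prop :=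
  (∀ a x, 0 ≤ k a x) ∧
  (∀ a x y, (∀ t, E t s → x t = y t) → k a x = k a y) ∧
  (∀ x, ∑ a, k a x = 1)

/-- `p` factorizes over the graph `E`: it is a product of kernel functions, one per node. -/
def Factorizes (E : V → V → Prop) (p : (∀ v, X v) → ℝ) : Prop :=
  ∃ k : ∀ s, X s → (∀ v, X v) → ℝ,
    (∀ s, IsKernel X E s (k s)) ∧ ∀ x, p x = ∏ s, k s (x s) x

variable [∀ v, DecidableEq (X v)]

/-- The marginal of `p` on the coordinates in `C`, evaluated at (the `C`-part of) `x`. -/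
def marg (p : (∀ v, X v) → ℝ) (C : Finset V) (x : ∀ v, X v) : ℝ :=
  ∑ y, if ∀ v ∈ C, y v = x v then p y else 0

/-- Conditional independence `A ⟂⟂ B ∣ S` w.r.t. the pmf `p`. -/
def CondIndep (p : (∀ v, X v) → ℝ) (A B S : Finset V) : Prop :=
  ∀ x, 0 < marg X p S x →
    marg X p (A ∪ B ∪ S) x * marg X p S x = marg X p (A ∪ S) x * marg X p (B ∪ S) x

/-- `q` is a conditional system for `N ∖ A` given `A`: a family of pmfs on `X_{N∖A}`,
one for every configuration on `A`.  Here `q x` encodes `q(x_{N∖A} ∣ x_A)`. -/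
def IsCondSystem (A : Finset V) (q : (∀ v, X v) → ℝ) : Prop :=
  (∀ x, 0 ≤ q x) ∧ ∀ x : ∀ v, X v, (∑ y, if ∀ v ∈ A, y v = x v then q y else 0) = 1

/-- The conditional system `q` for `N ∖ A` given `A` factorizes over the graph `E`. -/
def CondFactorizes (E : V → V → Prop) (A : Finset V) (q : (∀ v, X v) → ℝ) : Prop :=
  ∃ k : ∀ s, X s → (∀ v, X v) → ℝ,
    (∀ s ∉ A, IsKernel X E s (k s)) ∧ ∀ x, q x = ∏ s ∈ Finset.univ \ A, k s (x s) x

/-- The conditional system `q` for `N ∖ A` given `A` is a version of the conditional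
distribution of the pmf `p`. -/
def IsVersionOf (A : Finset V) (q p : (∀ v, X v) → ℝ) : Prop :=
  ∀ x, p x = q x * marg X p A x

/-- `G'` (edges `E'`) satisfies Goal I for `G` (edges `E`): `roots(G') ⊇ leaves(G)` and for
every pmf factorizing over `G` there is a conditional system for `N ∖ leaves(G)` given
`leaves(G)` factorizing over `G'` which is a version of its conditional distribution. -/
def GoalI (E E' : V → V → Prop) [DecidableRel E] : Prop :=
  (∀ s ∈ leavesF E, ∀ t, ¬ E' t s) ∧
  ∀ p : (∀ v, X v) → ℝ, IsPMF X p → Factorizes X E p →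
    ∃ q, IsCondSystem X (leavesF E) q ∧ CondFactorizes X E' (leavesF E) q ∧
      IsVersionOf X (leavesF E) q p

/-- `G'` (edges `E'`) satisfies Goal II for `G` (edges `E`): `P^{G'} ⊇ P^G` and every parent
in `G'` of a leaf of `G` is itself a leaf of `G`. -/
def GoalII (E E' : V → V → Prop) : Prop :=
  (∀ p : (∀ v, X v) → ℝ, IsPMF X p → Factorizes X E p → Factorizes X E' p) ∧
  ∀ s t, (∀ u, ¬ E s u) → E' t s → ∀ u, ¬ E t u

end Prob

section Walks

variable {V : Type*}

/-- Position `i` of the node sequence `w 0, …, w n` is a collider. -/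
def ColliderAt (E : V → V → Prop) (w : ℕ → V) (n i : ℕ) : Prop :=
  ∃ j, i = j + 1 ∧ j + 1 < n ∧ E (w j) (w (j + 1)) ∧ E (w (j + 2)) (w (j + 1))

/-- Position `i` of the node sequence `w 0, …, w n` does not block given `S`. -/
def OpenAt (E : V → V → Prop) (S : Set V) (w : ℕ → V) (n i : ℕ) : Prop :=
  (ColliderAt E w n i → ∃ t ∈ S, Relation.ReflTransGen E (w i) t) ∧
    (¬ ColliderAt E w n i → w i ∉ S)

/-- `w 0, …, w n` is a walk, possibly with repeated nodes, that is nowhere blocked by `S`. -/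
def OpenWalk (E : V → V → Prop) (S : Set V) (w : ℕ → V) (n : ℕ) : Prop :=
  (∀ i < n, GJoined E (w i) (w (i + 1))) ∧ ∀ i ≤ n, OpenAt E S w n i

lemma vStruct_iff_getElem (E : V → V → Prop) (l : List V) (u : V) :
    VStruct E l u ↔ ∃ (j : ℕ) (h : j + 2 < l.length),
      l[j + 1] = u ∧ E l[j] u ∧ E l[j + 2] u := by
  constructor
  · rintro ⟨l₁, l₂, a, b, rfl, ha, hb⟩
    refine ⟨l₁.length, by simp, ?_, ?_, ?_⟩
    · simp
    · simpa using ha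
    · simpa using hb
  · rintro ⟨j, h, rfl, ha, hb⟩
    refine ⟨l.take j, l.drop (j + 3), l[j], l[j + 2], ?_, ha, hb⟩
    rw [← List.drop_eq_getElem_cons, ← List.drop_eq_getElem_cons, ← List.drop_eq_getElem_cons,
      List.take_append_drop]

lemma not_blockedBy_map_range_iff (E : V → V → Prop) (S : Set V) (w : ℕ → V) (n : ℕ)
    (hinj : ∀ i ≤ n, ∀ j ≤ n, w i = w j → i = j) :
    ¬ BlockedBy E S ((List.range (n + 1)).map w) ↔ ∀ i ≤ n, OpenAt E S w n i := by
  have hv : ∀ i ≤ n, VStruct E ((List.range (n + 1)).map w) (w i) ↔ ColliderAt E w n i := by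
    intro i hi
    rw [vStruct_iff_getElem]
    constructor
    · rintro ⟨j, h, h1, h2, h3⟩
      simp at h h1 h2 h3
      have := hinj _ (by omega) _ hi h1
      subst this
      exact ⟨j, rfl, by omega, h2, h3⟩
    · rintro ⟨j, rfl, h, h2, h3⟩
      exact ⟨j, by simp; omega, by simp, by simpa using h2, by simpa using h3⟩
  have hd : ∀ u, (∃ t ∈ S, Relation.ReflTransGen E u t) ↔
      ¬ (u ∉ S ∧ ∀ t ∈ desG E u, t ∉ S) := by
    intro u
    constructor
    · rintro ⟨t, ht, hut⟩ ⟨h1, h2⟩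
      rcases Relation.reflTransGen_iff_eq_or_transGen.1 hut with h | h
      · exact h1 (h ▸ ht)
      · exact h2 t h ht
    · intro h
      by_cases hu : u ∈ S
      · exact ⟨u, hu, .refl⟩
      · by_contra hc
        exact h ⟨hu, fun t ht hS => hc ⟨t, hS, ht.to_reflTransGen⟩⟩
  constructor
  · intro h i hi
    have hm : w i ∈ (List.range (n + 1)).map w := List.mem_map.2 ⟨i, by simp; omega, rfl⟩
    refine ⟨fun hc => (hd _).2 fun hh => h ⟨w i, hm, Or.inr ⟨(hv i hi).2 hc, hh⟩⟩,
      fun hc hS => h ⟨w i, hm, Or.inl ⟨hS, fun hh => hc ((hv i hi).1 hh)⟩⟩⟩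
  · rintro h ⟨u, hu, hb⟩
    obtain ⟨i, hi, rfl⟩ := List.mem_map.1 hu
    have hi : i ≤ n := by simp at hi; omega
    rcases hb with ⟨hS, hc⟩ | ⟨hc, hh⟩
    · exact (h i hi).2 (fun hh => hc ((hv i hi).2 hh)) hS
    · exact (hd _).1 ((h i hi).1 ((hv i hi).1 hc)) hh

lemma isTrail_map_range_iff (E : V → V → Prop) (w : ℕ → V) (n : ℕ) :
    IsTrail E ((List.range (n + 1)).map w) ↔
      (∀ i ≤ n, ∀ j ≤ n, w i = w j → i = j) ∧ ∀ i < n, GJoined E (w i) (w (i + 1)) := by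
  have h1 : ((List.range (n + 1)).map w).Nodup ↔ ∀ i ≤ n, ∀ j ≤ n, w i = w j → i = j := by
    rw [List.nodup_map_iff_inj_on List.nodup_range]
    simp only [List.mem_range, Nat.lt_succ_iff]
  have h2 : ((List.range (n + 1)).map w).IsChain (GJoined E) ↔
      ∀ i < n, GJoined E (w i) (w (i + 1)) := by
    rw [List.isChain_iff_getElem]
    simp
  unfold IsTrail
  rw [h1]
  simp only [ne_eq, List.map_eq_nil_iff, List.range_eq_nil, Nat.succ_ne_zero, not_false_eq_true,
    true_and]
  exact and_congr_right fun _ => h2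

/-- d-separation fails exactly when there is an open walk without repeated nodes. -/
lemma not_dSep_iff_exists_openWalk (E : V → V → Prop) (A B S : Set V) :
    ¬ DSep E A B S ↔ ∃ (w : ℕ → V) (n : ℕ), OpenWalk E S w n ∧
      (∀ i ≤ n, ∀ j ≤ n, w i = w j → i = j) ∧ w 0 ∈ A ∧ w n ∈ B := by
  constructor
  · intro h
    unfold DSep at h
    push Not at h
    obtain ⟨l, a, b, hl, ha, hb, haA, hbB, hbl⟩ := h
    obtain ⟨n, hn⟩ : ∃ n, l.length = n + 1 :=
      ⟨l.length - 1, by have := List.length_pos_of_ne_nil hl.1; omega⟩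
    have hlw : l = (List.range (n + 1)).map fun i => l.getD i a := by
      apply List.ext_getElem
      · simp [hn]
      · intro i h1 h2
        simp [List.getElem?_eq_getElem h1]
    have h0 : l.getD 0 a = a := by
      rw [List.head?_eq_getElem?] at ha
      simp [ha]
    have hn' : l.getD n a = b := by
      rw [List.getLast?_eq_getElem?, hn] at hb
      simp at hb
      simp [hb]
    obtain ⟨w, hw⟩ : ∃ w : ℕ → V, w = fun i => l.getD i a := ⟨_, rfl⟩
    rw [← hw] at hlw
    rw [hlw] at hl hbl
    obtain ⟨hinj, hj⟩ := (isTrail_map_range_iff E w n).1 hl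
    refine ⟨w, n, ⟨hj, (not_blockedBy_map_range_iff E S w n hinj).1 hbl⟩, hinj, ?_, ?_⟩
    · rw [hw]; show l.getD 0 a ∈ A; rwa [h0]
    · rw [hw]; show l.getD n a ∈ B; rwa [hn']
  · rintro ⟨w, n, ⟨hj, ho⟩, hinj, h0, hn⟩ hd
    refine (not_blockedBy_map_range_iff E S w n hinj).2 ho
      (hd _ (w 0) (w n) ((isTrail_map_range_iff E w n).2 ⟨hinj, hj⟩) ?_ ?_ h0 hn)
    · simp [List.range_succ_eq_map]
    · simp [List.range_succ]
/-- A walk leaving position `i` along an outgoing edge follows a directed path up to position `m`,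
unless it meets a collider before. -/
lemma OpenWalk.transGen_or_exists_mem {E : V → V → Prop} {S : Set V} {w : ℕ → V} {n i : ℕ}
    (h : OpenWalk E S w n) (hi : E (w i) (w (i + 1))) (m : ℕ) (hm : i + m + 1 ≤ n) :
    (Relation.TransGen E (w i) (w (i + m + 1)) ∧ E (w (i + m)) (w (i + m + 1))) ∨
      ∃ t ∈ S, Relation.ReflTransGen E (w i) t := by
  induction m with
  | zero => exact Or.inl ⟨.single hi, hi⟩
  | succ m ih =>
    rcases ih (by omega) with ⟨h1, h2⟩ | h1
    · rcases h.1 (i + m + 1) (by omega) with h3 | h3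
      · exact Or.inl ⟨h1.tail h3, h3⟩
      · obtain ⟨t, ht, ht'⟩ := (h.2 (i + m + 1) (by omega)).1 ⟨i + m, rfl, by omega, h2, h3⟩
        exact Or.inr ⟨t, ht, h1.to_reflTransGen.trans ht'⟩
    · exact Or.inr h1

/-- Cutting a closed piece out of an open walk in a DAG leaves an open walk. -/
lemma OpenWalk.cut {E : V → V → Prop} (hE : IsDAG E) {S : Set V} {w : ℕ → V} {n i d : ℕ}
    (h : OpenWalk E S w n) (hd : 0 < d) (hn : i + d ≤ n) (hw : w i = w (i + d)) :
    OpenWalk E S (fun m => if m ≤ i then w m else w (m + d)) (n - d) := by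
  set w' : ℕ → V := fun m => if m ≤ i then w m else w (m + d) with hw'
  have hlo : ∀ m, m ≤ i → w' m = w m := fun m hm => if_pos hm
  have hhi : ∀ m, i ≤ m → w' m = w (m + d) := by
    intro m hm
    rcases hm.eq_or_lt with rfl | hm
    · rw [hlo _ le_rfl, hw]
    · exact if_neg (by omega)
  refine ⟨fun m hm => ?_, fun m hm => ?_⟩
  · rcases lt_or_ge m i with hmi | hmi
    · rw [hlo _ hmi.le, hlo _ hmi]
      exact h.1 m (by omega)
    · rw [hhi _ hmi, hhi _ (by omega), show m + 1 + d = m + d + 1 by omega]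
      exact h.1 (m + d) (by omega)
  · rcases lt_trichotomy m i with hmi | rfl | hmi
    · have hc : ColliderAt E w' (n - d) m ↔ ColliderAt E w n m := by
        unfold ColliderAt
        refine exists_congr fun j => and_congr_right fun hj => ?_
        rw [hlo j (by omega), hlo (j + 1) (by omega), hlo (j + 2) (by omega)]
        exact and_congr_left fun _ => by omega
      unfold OpenAt
      rw [hc, hlo _ hmi.le]
      exact h.2 m (by omega)
    · have hwm : w' m = w m := hlo m le_rfl
      unfold OpenAt
      rw [hwm]
      constructor
      · rintro ⟨j, rfl, hj, h1, h2⟩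
        rw [hlo j (by omega), hlo _ le_rfl] at h1
        rcases h.1 (j + 1) (by omega) with h3 | h3
        · rcases h.transGen_or_exists_mem h3 (d - 1) (by omega) with h4 | h4
          · rw [show j + 1 + (d - 1) + 1 = j + 1 + d by omega, ← hw] at h4
            exact absurd h4.1 (hE _)
          · exact h4
        · exact (h.2 (j + 1) (by omega)).1 ⟨j, rfl, by omega, h1, h3⟩
      · intro hnc
        by_cases hc1 : ColliderAt E w n m
        · by_cases hc2 : ColliderAt E w n (m + d)
          · exfalso
            obtain ⟨j, rfl, hj, h1, h2⟩ := hc1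
            obtain ⟨j', hj', hj2, h3, h4⟩ := hc2
            obtain rfl : j' = j + d := by omega
            refine hnc ⟨j, rfl, by omega, ?_, ?_⟩
            · rwa [hlo j (by omega), hlo _ le_rfl]
            · rw [hhi (j + 2) (by omega), hhi (j + 1) le_rfl]
              convert h4 using 2; omega
          · rw [hw]
            exact (h.2 (m + d) (by omega)).2 hc2
        · exact (h.2 m (by omega)).2 hc1
    · have hc : ColliderAt E w' (n - d) m ↔ ColliderAt E w n (m + d) := by
        constructor
        · rintro ⟨j, rfl, hj, h1, h2⟩
          rw [hhi j (by omega), hhi (j + 1) (by omega)] at h1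
          rw [hhi (j + 2) (by omega), hhi (j + 1) (by omega)] at h2
          refine ⟨j + d, by omega, by omega, ?_, ?_⟩
          · convert h1 using 2; omega
          · convert h2 using 2 <;> omega
        · rintro ⟨j, hj, hj2, h1, h2⟩
          obtain ⟨j, rfl⟩ : ∃ j', j = j' + d := ⟨j - d, by omega⟩
          refine ⟨j, by omega, by omega, ?_, ?_⟩
          · rw [hhi j (by omega), hhi (j + 1) (by omega)]
            convert h1 using 2; omega
          · rw [hhi (j + 2) (by omega), hhi (j + 1) (by omega)]
            convert h2 using 2 <;> omega
      unfold OpenAt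
      rw [hc, hhi _ hmi.le]
      exact h.2 (m + d) (by omega)

/-- In a DAG, an open walk can be shortened to one without repeated nodes. -/
lemma OpenWalk.exists_injOn {E : V → V → Prop} (hE : IsDAG E) {S : Set V} {w : ℕ → V} {n : ℕ}
    (h : OpenWalk E S w n) :
    ∃ (w' : ℕ → V) (n' : ℕ), OpenWalk E S w' n' ∧
      (∀ i ≤ n', ∀ j ≤ n', w' i = w' j → i = j) ∧ w' 0 = w 0 ∧ w' n' = w n := by
  induction n using Nat.strong_induction_on generalizing w with
  | _ n ih =>
    by_cases hinj : ∀ i ≤ n, ∀ j ≤ n, w i = w j → i = j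
    · exact ⟨w, n, h, hinj, rfl, rfl⟩
    · have : ∃ i d, 0 < d ∧ i + d ≤ n ∧ w i = w (i + d) := by
        push Not at hinj
        obtain ⟨i, hi, j, hj, hij, hne⟩ := hinj
        rcases lt_or_gt_of_ne hne with hlt | hlt
        · exact ⟨i, j - i, by omega, by omega, by rw [hij]; congr 1; omega⟩
        · exact ⟨j, i - j, by omega, by omega, by rw [← hij]; congr 1; omega⟩
      obtain ⟨i, d, hd, hn, hw⟩ := this
      obtain ⟨w', n', h1, h2, h3, h4⟩ := ih (n - d) (by omega) (h.cut hE hd hn hw)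
      refine ⟨w', n', h1, h2, by simpa using h3, ?_⟩
      rw [h4]
      rcases eq_or_ne (i + d) n with h5 | h5
      · simp only [show n - d ≤ i by omega, if_true]
        rw [show n - d = i by omega, hw, h5]
      · simp only [show ¬ n - d ≤ i by omega, if_false]
        congr 1; omega

/-- `SDesc E S u v`: there is a directed path from `u` to `v` all of whose nodes, except possibly
`v`, lie outside `S`. -/
def SDesc (E : V → V → Prop) (S : Set V) : V → V → Prop :=
  Relation.ReflTransGen fun u v => u ∉ S ∧ E u v

/-- The nodes outside `S` that are d-connected to `A` given `S` along a walk
whose last edge does not point to the final node. -/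
inductive SLinked (E : V → V → Prop) (S A : Set V) : V → Prop
  | base {r a : V} : a ∈ A → a ∉ S → SDesc E S r a → SLinked E S A r
  | link {r r' s : V} : SLinked E S A r → SDesc E S r s → s ∈ S → SDesc E S r' s → r' ∉ S →
      SLinked E S A r'

lemma SLinked.notMem {E : V → V → Prop} {S A : Set V} {r : V} (h : SLinked E S A r) : r ∉ S := by
  cases h with
  | base _ ha hd =>
    rcases Relation.ReflTransGen.cases_head hd with rfl | ⟨_, h, _⟩
    · exact ha
    · exact h.1
  | link _ _ _ _ h => exact h

lemma SLinked.of_sDesc {E : V → V → Prop} {S A : Set V} {r r' : V} (h : SLinked E S A r)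
    (hd : SDesc E S r' r) : SLinked E S A r' := by
  have hr' : r' ∉ S := by
    rcases Relation.ReflTransGen.cases_head hd with rfl | ⟨_, h', _⟩
    · exact h.notMem
    · exact h'.1
  cases h with
  | base ha haS h' => exact .base ha haS (hd.trans h')
  | link h1 h2 h3 h4 h5 => exact .link h1 h2 h3 (hd.trans h4) hr'

/-- A node with a descendant in `S` has an `S`-avoiding directed path to `S`. -/
lemma exists_sDesc_of_reflTransGen {E : V → V → Prop} {S : Set V} {u t : V}
    (h : Relation.ReflTransGen E u t) (ht : t ∈ S) : ∃ s ∈ S, SDesc E S u s := by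
  induction h using Relation.ReflTransGen.head_induction_on with
  | refl => exact ⟨t, ht, .refl⟩
  | @head a c hac _ ih =>
    by_cases ha : a ∈ S
    · exact ⟨a, ha, .refl⟩
    · obtain ⟨s, hs, hd⟩ := ih
      exact ⟨s, hs, .head ⟨ha, hac⟩ hd⟩

/-- The endpoint of an open walk from `A` has an ancestor in `SLinked`. -/
lemma OpenWalk.exists_sLinked {E : V → V → Prop} (hE : IsDAG E) {S A : Set V} {w : ℕ → V} {n : ℕ}
    (h : OpenWalk E S w n) (h0 : w 0 ∈ A) : ∃ r, SLinked E S A r ∧ SDesc E S r (w n) := by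
  have asymm : ∀ {u v}, E u v → ¬ E v u := fun h1 h2 => hE _ (.tail (.single h1) h2)
  have key : ∀ i ≤ n, SLinked E S A (w i) ∨
      ∃ j, i = j + 1 ∧ E (w j) (w i) ∧ ∃ r, SLinked E S A r ∧ SDesc E S r (w i) := by
    intro i
    induction i with
    | zero =>
      intro _
      exact Or.inl (.base h0 ((h.2 0 (by omega)).2 fun ⟨j, hj, _⟩ => by omega) .refl)
    | succ i ih =>
      intro hi
      have hr : ∃ r, SLinked E S A r ∧ SDesc E S r (w i) := by
        rcases ih (by omega) with h1 | ⟨j, _, _, h1⟩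
        · exact ⟨_, h1, .refl⟩
        · exact h1
      obtain ⟨r, hr, hd⟩ := hr
      rcases h.1 i (by omega) with he | he
      · refine Or.inr ⟨i, rfl, he, r, hr, hd.tail ⟨(h.2 i (by omega)).2 ?_, he⟩⟩
        rintro ⟨j, rfl, _, _, h1⟩
        exact asymm h1 he
      · have hS : w (i + 1) ∉ S := by
          refine (h.2 (i + 1) hi).2 ?_
          rintro ⟨j, hj, _, h1, _⟩
          obtain rfl : i = j := by omega
          exact asymm h1 he
        rcases ih (by omega) with h1 | ⟨j, rfl, hj, -⟩
        · exact Or.inl (h1.of_sDesc (.single ⟨hS, he⟩))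
        · obtain ⟨t, ht, hwt⟩ := (h.2 (j + 1) (by omega)).1 ⟨j, rfl, by omega, hj, he⟩
          obtain ⟨s, hs, hds⟩ := exists_sDesc_of_reflTransGen hwt ht
          exact Or.inl (.link hr (hd.trans hds) hs (.head ⟨hS, he⟩ hds) hS)
  rcases key n le_rfl with h1 | ⟨_, _, _, h1⟩
  · exact ⟨_, h1, .refl⟩
  · exact h1

/-- `w 0, …, w n` is an open walk from `A`, except that nothing is required at its endpoint. -/
def OpenBefore (E : V → V → Prop) (S A : Set V) (w : ℕ → V) (n : ℕ) : Prop :=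
  w 0 ∈ A ∧ (∀ i < n, GJoined E (w i) (w (i + 1))) ∧ ∀ i < n, OpenAt E S w n i

/-- The last edge of `w 0, …, w n` exists and points to `w n`. -/
def EndsDown (E : V → V → Prop) (w : ℕ → V) (n : ℕ) : Prop :=
  ∃ j, n = j + 1 ∧ E (w j) (w n)

lemma OpenBefore.extend {E : V → V → Prop} {S A : Set V} {w : ℕ → V} {n : ℕ} {u : V}
    (h : OpenBefore E S A w n) (hj : GJoined E (w n) u)
    (h1 : EndsDown E w n → E u (w n) → w n ∈ S)
    (h2 : ¬ (EndsDown E w n ∧ E u (w n)) → w n ∉ S) :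
    ∃ w', OpenBefore E S A w' (n + 1) ∧ w' n = w n ∧ w' (n + 1) = u := by
  set w' : ℕ → V := fun m => if m ≤ n then w m else u with hw'
  have hlo : ∀ m, m ≤ n → w' m = w m := fun m hm => if_pos hm
  have hu : w' (n + 1) = u := if_neg (by omega)
  refine ⟨w', ⟨?_, fun i hi => ?_, fun i hi => ?_⟩, hlo n le_rfl, hu⟩
  · rw [hlo 0 (by omega)]; exact h.1
  · rcases Nat.lt_succ_iff_lt_or_eq.1 hi with hi | rfl
    · rw [hlo i hi.le, hlo (i + 1) hi]; exact h.2.1 i hi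
    · rw [hlo i le_rfl, hu]; exact hj
  · rcases Nat.lt_succ_iff_lt_or_eq.1 hi with hi | rfl
    · have hc : ColliderAt E w' (n + 1) i ↔ ColliderAt E w n i := by
        unfold ColliderAt
        refine exists_congr fun j => and_congr_right fun hj => ?_
        rw [hlo j (by omega), hlo (j + 1) (by omega), hlo (j + 2) (by omega)]
        exact and_congr_left fun _ => by omega
      unfold OpenAt
      rw [hc, hlo _ hi.le]
      exact h.2.2 i hi
    · have hc : ColliderAt E w' (i + 1) i ↔ EndsDown E w i ∧ E u (w i) := by
        constructor
        · rintro ⟨j, rfl, _, h3, h4⟩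
          rw [hlo j (by omega), hlo _ le_rfl] at h3
          rw [hu, hlo _ le_rfl] at h4
          exact ⟨⟨j, rfl, h3⟩, h4⟩
        · rintro ⟨⟨j, rfl, h3⟩, h4⟩
          refine ⟨j, rfl, by omega, ?_, ?_⟩
          · rwa [hlo j (by omega), hlo _ le_rfl]
          · rwa [hu, hlo _ le_rfl]
      unfold OpenAt
      rw [hc, hlo _ le_rfl]
      exact ⟨fun hh => ⟨_, h1 hh.1 hh.2, .refl⟩, h2⟩

lemma OpenBefore.exists_down {E : V → V → Prop} (hE : IsDAG E) {S A : Set V} {r x : V}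
    (hr : ∃ w n, OpenBefore E S A w n ∧ w n = r) (hd : SDesc E S r x) :
    ∃ w n, OpenBefore E S A w n ∧ w n = x ∧ (r ≠ x → EndsDown E w n) := by
  induction hd with
  | refl =>
    obtain ⟨w, n, h1, h2⟩ := hr
    exact ⟨w, n, h1, h2, fun h => absurd rfl h⟩
  | @tail y z _ hyz ih =>
    obtain ⟨w, n, h1, rfl, -⟩ := ih
    have hn : ¬ E z (w n) := fun h => hE _ (.tail (.single h) hyz.2)
    obtain ⟨w', h3, h4, h5⟩ := h1.extend (Or.inl hyz.2) (fun _ h => absurd h hn) fun _ => hyz.1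
    exact ⟨w', n + 1, h3, h5, fun _ => ⟨n, rfl, by rw [h4, h5]; exact hyz.2⟩⟩

lemma OpenBefore.exists_up {E : V → V → Prop} (hE : IsDAG E) {S A : Set V} {r x : V}
    (hx : ∃ w n, OpenBefore E S A w n ∧ w n = x ∧
      (x ∈ S → EndsDown E w n) ∧ (x ∉ S → ¬ EndsDown E w n))
    (hd : SDesc E S r x) :
    ∃ w n, OpenBefore E S A w n ∧ w n = r ∧
      (r ∈ S → EndsDown E w n) ∧ (r ∉ S → ¬ EndsDown E w n) := by
  induction hd using Relation.ReflTransGen.head_induction_on with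
  | refl => exact hx
  | @head y z hyz _ ih =>
    obtain ⟨w, n, h1, rfl, h2, h2'⟩ := ih
    obtain ⟨w', h3, h4, h5⟩ := h1.extend (Or.inr hyz.2)
      (fun h _ => by by_contra hc; exact h2' hc h) fun h hS => h ⟨h2 hS, hyz.2⟩
    refine ⟨w', n + 1, h3, h5, fun h => absurd h hyz.1, fun _ => ?_⟩
    rintro ⟨j, hj, h6⟩
    obtain rfl : n = j := by omega
    rw [h4, h5] at h6
    exact hE _ (.tail (.single h6) hyz.2)

lemma SLinked.exists_openBefore {E : V → V → Prop} (hE : IsDAG E) {S A : Set V} {r : V}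
    (h : SLinked E S A r) : ∃ w n, OpenBefore E S A w n ∧ w n = r ∧ ¬ EndsDown E w n := by
  induction h with
  | @base r a ha haS hd =>
    have hr : r ∉ S := (SLinked.base ha haS hd).notMem
    obtain ⟨w, n, h1, h2, h3, h4⟩ := OpenBefore.exists_up hE (A := A)
      ⟨fun _ => a, 0, ⟨ha, by simp, by simp⟩, rfl, fun h => absurd h haS,
        fun _ ⟨j, hj, _⟩ => by omega⟩ hd
    exact ⟨w, n, h1, h2, h4 hr⟩
  | @link r r' s hr hd hs hd' hr' ih =>
    obtain ⟨w, n, h1, h2, -⟩ := ih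
    obtain ⟨w, n, h1, h2, h3⟩ := OpenBefore.exists_down hE ⟨w, n, h1, h2⟩ hd
    obtain ⟨w, n, h1, h2, h3, h4⟩ := OpenBefore.exists_up hE
      ⟨w, n, h1, h2, fun _ => h3 fun h => hr.notMem (h ▸ hs), fun h => absurd hs h⟩ hd'
    exact ⟨w, n, h1, h2, h4 hr'⟩

/-- d-separation in a DAG in terms of common `S`-avoiding ancestors. -/
lemma dSep_iff_forall_sLinked {E : V → V → Prop} (hE : IsDAG E) (A B S : Set V) :
    DSep E A B S ↔ ∀ r, SLinked E S A r → ∀ b ∈ B, b ∉ S → ¬ SDesc E S r b := by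
  constructor
  · intro h r hr b hb hbS hd
    obtain ⟨w, n, h1, h2, -⟩ := hr.exists_openBefore hE
    obtain ⟨w, n, h1, rfl, -⟩ := OpenBefore.exists_down hE ⟨w, n, h1, h2⟩ hd
    have ho : OpenWalk E S w n := by
      refine ⟨h1.2.1, fun i hi => ?_⟩
      rcases hi.eq_or_lt with rfl | hi
      · exact ⟨fun ⟨j, hj, hj', _⟩ => by omega, fun _ => hbS⟩
      · exact h1.2.2 i hi
    obtain ⟨w', n', h3, h4, h5, h6⟩ := ho.exists_injOn hE
    exact (not_dSep_iff_exists_openWalk E A B S).2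
      ⟨w', n', h3, h4, h5 ▸ h1.1, h6 ▸ hb⟩ h
  · intro h
    by_contra hc
    obtain ⟨w, n, h1, -, h3, h4⟩ := (not_dSep_iff_exists_openWalk E A B S).1 hc
    obtain ⟨r, hr, hd⟩ := h1.exists_sLinked hE h3
    exact h r hr _ h4 ((h1.2 n le_rfl).2 fun ⟨j, hj, hj', _⟩ => by omega) hd

/-- The ordered local Markov property for d-separation. -/
lemma dSep_parents {E : V → V → Prop} (hE : IsDAG E) {C : Set V}
    (hC : ∀ s ∈ C, ∀ t, E t s → t ∈ C) {s : V} (hs : s ∉ C) : DSep E {s} C (paG E s) := by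
  rw [dSep_iff_forall_sLinked hE]
  have hs' : ∀ {r}, SDesc E (paG E s) r s → r = s := by
    intro r h
    rcases Relation.ReflTransGen.cases_tail h with h | ⟨q, _, h1, h2⟩
    · exact h.symm
    · exact absurd h2 h1
  have hmono : ∀ {u v}, SDesc E (paG E s) u v → Relation.ReflTransGen E u v :=
    fun h => Relation.ReflTransGen.mono (fun _ _ h => h.2) _ _ h
  have hr : ∀ r, SLinked E (paG E s) {s} r → r = s := by
    intro r h
    induction h with
    | base ha _ hd =>
      rw [Set.mem_singleton_iff.1 ha] at hd
      exact hs' hd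
    | link _ hd ht _ _ ih =>
      rw [ih] at hd
      exact absurd (Relation.TransGen.tail' (hmono hd) ht) (hE s)
  intro r h b hb _ hd
  rw [hr r h] at hd
  have hanc : ∀ u, Relation.ReflTransGen E u b → u ∈ C := by
    intro u hu
    induction hu using Relation.ReflTransGen.head_induction_on with
    | refl => exact hb
    | head h _ ih => exact hC _ ih _ h
  exact hs (hanc s (hmono hd))

end Walks

lemma IsKernel.congr {V : Type*} {X : V → Type*} [∀ v, Fintype (X v)] {E : V → V → Prop} {s : V}
    {k : X s → (∀ v, X v) → ℝ}
    (hk : IsKernel X E s k) {x y : ∀ v, X v} (hs : x s = y s) (h : ∀ t, E t s → x t = y t) :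
    k (x s) x = k (y s) y := by
  rw [hs, hk.2.1 _ x y h]

lemma ite_zero_mul_ite_zero_congr {P Q P' Q' : Prop} [Decidable P] [Decidable Q] [Decidable P']
    [Decidable Q'] {a b c d : ℝ} (h : P ∧ Q ↔ P' ∧ Q') (hab : P ∧ Q → a * b = c * d) :
    (if P then a else 0) * (if Q then b else 0) =
      (if P' then c else 0) * (if Q' then d else 0) := by
  rw [ite_zero_mul_ite_zero, ite_zero_mul_ite_zero]
  by_cases hc : P ∧ Q
  · rw [if_pos hc, if_pos (h.1 hc), hab hc]
  · rw [if_neg hc, if_neg fun h' => hc (h.2 h')]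

section Factorization

variable {V : Type*} [Fintype V] [DecidableEq V]

/-- Ancestrally closed node sets of a DAG can be built up to the full node set by adding one node
at a time. -/
lemma IsDAG.closed_induction {E : V → V → Prop} (hE : IsDAG E) {P : Finset V → Prop}
    {H : Finset V} (hH : ∀ s ∈ H, ∀ t, E t s → t ∈ H) (h0 : P H)
    (step : ∀ C : Finset V, H ⊆ C → (∀ s ∈ C, ∀ t, E t s → t ∈ C) →
      ∀ s ∉ C, (∀ t, E t s → t ∈ C) → P C → P (insert s C)) : P univ := by
  have wf : WellFounded (Relation.TransGen E) :=
    have : IsTrans V (Relation.TransGen E) := ⟨fun _ _ _ => Relation.TransGen.trans⟩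
    have : Std.Irrefl (Relation.TransGen E) := ⟨hE⟩
    Finite.wellFounded_of_trans_of_irrefl _
  have main : ∀ (n : ℕ) (C : Finset V), (univ \ C).card = n → H ⊆ C →
      (∀ s ∈ C, ∀ t, E t s → t ∈ C) → P C → P univ := by
    intro n
    induction n with
    | zero =>
      intro C hC _ _ hP
      rw [card_eq_zero, sdiff_eq_empty_iff_subset, univ_subset_iff] at hC
      exact hC ▸ hP
    | succ n ih =>
      intro C hC hHC hcl hP
      have hne : {v | v ∉ C}.Nonempty := by
        obtain ⟨v, hv⟩ := card_pos.1 (hC.symm ▸ Nat.succ_pos n : 0 < (univ \ C).card)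
        exact ⟨v, by simpa using hv⟩
      obtain ⟨s, hs, hmin⟩ := wf.has_min {v | v ∉ C} hne
      have hpa : ∀ t, E t s → t ∈ C := fun t ht => by
        by_contra hc
        exact hmin t hc (.single ht)
      refine ih (insert s C) ?_ (hHC.trans (subset_insert _ _)) ?_ (step C hHC hcl s hs hpa hP)
      · rw [sdiff_insert, card_erase_of_mem (by simpa using hs), hC]
        rfl
      · intro v hv t ht
        rcases mem_insert.1 hv with rfl | hv
        · exact mem_insert_of_mem (hpa t ht)
        · exact mem_insert_of_mem (hcl v hv t ht)
  exact main _ H rfl subset_rfl hH h0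

variable {X : V → Type*} [∀ v, Fintype (X v)]

lemma sum_sum_update (s : V) (φ : (∀ v, X v) → ℝ) :
    ∑ y, ∑ a : X s, φ (Function.update y s a) = Fintype.card (X s) * ∑ y, φ y := by
  have h : ∑ z : (∀ v, X v) × X s, φ (Function.update z.1 s z.2) =
      ∑ z : (∀ v, X v) × X s, φ z.1 :=
    Fintype.sum_equiv
      (Function.Involutive.toPerm (fun z : (∀ v, X v) × X s => (Function.update z.1 s z.2, z.1 s))
        (fun z => by simp)) _ _ fun z => rfl
  rw [Fintype.sum_prod_type, Fintype.sum_prod_type] at h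
  rw [h]
  simp [mul_sum]

/-- Summing out a kernel at a node on which the remaining factor does not depend. -/
lemma card_mul_sum_mul_kernel {s : V} (F : (∀ v, X v) → ℝ) (k : X s → (∀ v, X v) → ℝ)
    (hF : ∀ y a, F (Function.update y s a) = F y)
    (hk : ∀ b y a, k b (Function.update y s a) = k b y) (h1 : ∀ y, ∑ a, k a y = 1) :
    Fintype.card (X s) * ∑ y, F y * k (y s) y = ∑ y, F y := by
  rw [← sum_sum_update]
  refine sum_congr rfl fun y _ => ?_
  simp only [hF, hk, Function.update_self]
  rw [← mul_sum, h1, mul_one]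

variable [∀ v, DecidableEq (X v)]

lemma marg_congr (p : (∀ v, X v) → ℝ) {C : Finset V} {x x' : ∀ v, X v}
    (h : ∀ v ∈ C, x v = x' v) : marg X p C x = marg X p C x' := by
  unfold marg
  refine sum_congr rfl fun y _ => if_congr (forall₂_congr fun v hv => ?_) rfl rfl
  rw [h v hv]

lemma marg_nonneg {p : (∀ v, X v) → ℝ} (hp : ∀ x, 0 ≤ p x) (C : Finset V) (x : ∀ v, X v) :
    0 ≤ marg X p C x :=
  sum_nonneg fun y _ => by split_ifs; exacts [hp y, le_rfl]

lemma marg_anti {p : (∀ v, X v) → ℝ} (hp : ∀ x, 0 ≤ p x) {C D : Finset V} (hCD : C ⊆ D)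
    (x : ∀ v, X v) : marg X p D x ≤ marg X p C x := by
  refine sum_le_sum fun y _ => ?_
  by_cases h : ∀ v ∈ D, y v = x v
  · rw [if_pos h, if_pos fun v hv => h v (hCD hv)]
  · rw [if_neg h]
    split_ifs
    exacts [hp y, le_rfl]

lemma marg_pos {p : (∀ v, X v) → ℝ} (hp : ∀ x, 0 ≤ p x) {C : Finset V} {x y : ∀ v, X v}
    (hy : 0 < p y) (h : ∀ v ∈ C, y v = x v) : 0 < marg X p C x := by
  refine sum_pos' (fun z _ => by split_ifs; exacts [hp z, le_rfl]) ⟨y, mem_univ _, ?_⟩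
  rwa [if_pos h]

lemma exists_of_marg_ne_zero {p : (∀ v, X v) → ℝ} {C : Finset V} {x : ∀ v, X v}
    (h : marg X p C x ≠ 0) : ∃ y, p y ≠ 0 ∧ ∀ v ∈ C, y v = x v := by
  obtain ⟨y, -, hy⟩ := exists_ne_zero_of_sum_ne_zero h
  by_cases hc : ∀ v ∈ C, y v = x v
  · rw [if_pos hc] at hy
    exact ⟨y, hy, hc⟩
  · exact absurd (if_neg hc) hy

lemma sum_marg_insert (p : (∀ v, X v) → ℝ) {C : Finset V} {s : V} (hs : s ∉ C) (x : ∀ v, X v) :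
    ∑ a, marg X p (insert s C) (Function.update x s a) = marg X p C x := by
  unfold marg
  rw [sum_comm]
  refine sum_congr rfl fun y _ => ?_
  have h : ∀ a, (∀ v ∈ insert s C, y v = Function.update x s a v) ↔
      (y s = a ∧ ∀ v ∈ C, y v = x v) := by
    intro a
    rw [forall_mem_insert, Function.update_self]
    refine and_congr_right fun _ => forall₂_congr fun v hv => ?_
    rw [Function.update_of_ne (ne_of_mem_of_not_mem hv hs)]
  simp only [h, ite_and]
  simp

/-- The marginal on an ancestrally closed set is, up to a constant, the product of its kernels. -/
lemma marg_prod_closed {E : V → V → Prop} (hE : IsDAG E) {k : ∀ s, X s → (∀ v, X v) → ℝ}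
    (hk : ∀ s, IsKernel X E s (k s)) {H C : Finset V} (hH : ∀ s ∈ H, ∀ t, E t s → t ∈ H)
    (hC : C ⊆ H) (x : ∀ v, X v) :
    marg X (fun y => ∏ s ∈ H, k s (y s) y) C x =
      (∏ v ∈ univ \ H, (Fintype.card (X v) : ℝ)) * marg X (fun y => ∏ s, k s (y s) y) C x := by
  refine hE.closed_induction (P := fun T => marg X (fun y => ∏ s ∈ H, k s (y s) y) C x =
      (∏ v ∈ T \ H, (Fintype.card (X v) : ℝ)) * marg X (fun y => ∏ s ∈ T, k s (y s) y) C x)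
    hH (by simp) fun T hT hcl s hs hpa ih => ?_
  have hsH : s ∉ H := fun h => hs (hT h)
  rw [ih, insert_sdiff_of_notMem _ hsH, prod_insert (fun h => hs (mem_sdiff.1 h).1),
    mul_comm (Fintype.card (X s) : ℝ), mul_assoc]
  congr 1
  have := card_mul_sum_mul_kernel (s := s)
    (fun y => if ∀ v ∈ C, y v = x v then ∏ t ∈ T, k t (y t) y else 0) (k s) ?_ ?_ (hk s).2.2
  · unfold marg
    rw [← this]
    congr 1
    refine sum_congr rfl fun y _ => ?_
    simp only [prod_insert hs]
    split_ifs <;> ring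
  · intro y a
    have h : ∀ t ∈ T, Function.update y s a t = y t := fun t ht =>
      Function.update_of_ne (ne_of_mem_of_not_mem ht hs) _ _
    refine if_congr (forall₂_congr fun v hv => ?_)
      (prod_congr rfl fun t ht => (hk t).congr (h t ht) fun u hu => h u (hcl t ht u hu)) rfl
    rw [h v (hT (hC hv))]
  · intro b y a
    refine (hk s).2.1 b _ _ fun t ht => Function.update_of_ne (ne_of_mem_of_not_mem (hpa t ht) hs) _ _

lemma isPMF_prod_kernel [∀ v, Nonempty (X v)] {E : V → V → Prop} (hE : IsDAG E)
    {k : ∀ s, X s → (∀ v, X v) → ℝ} (hk : ∀ s, IsKernel X E s (k s)) :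
    IsPMF X fun x => ∏ s, k s (x s) x := by
  refine ⟨fun x => prod_nonneg fun s _ => (hk s).1 _ _, ?_⟩
  have h := marg_prod_closed hE hk (H := ∅) (C := ∅) (by simp) (subset_refl _)
    (fun v => Classical.arbitrary (X v))
  simp only [marg, prod_empty, notMem_empty, false_imp_iff, implies_true, if_true, sum_const,
    card_univ, sdiff_empty, Fintype.card_pi, nsmul_eq_mul, mul_one, Nat.cast_prod] at h
  exact (mul_eq_left₀ (prod_ne_zero_iff.2 fun v _ =>
    Nat.cast_ne_zero.2 Fintype.card_ne_zero)).1 h.symm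

/-- A product of a function of the coordinates in `U ∪ S` and a function of the coordinates
outside `U` renders the two groups of coordinates independent given `S`. -/
lemma marg_mul_marg_of_split {U : Set V} {A B S : Finset V}
    (hA : ∀ v ∈ A, v ∉ S → v ∈ U) (hB : ∀ v ∈ B, v ∉ S → v ∉ U)
    {f g : (∀ v, X v) → ℝ}
    (hf : ∀ y z : ∀ v, X v, (∀ v, v ∈ U ∨ v ∈ S → y v = z v) → f y = f z)
    (hg : ∀ y z : ∀ v, X v, (∀ v, v ∉ U → y v = z v) → g y = g z) (x : ∀ v, X v) :
    marg X (fun y => f y * g y) (A ∪ B ∪ S) x * marg X (fun y => f y * g y) S x =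
      marg X (fun y => f y * g y) (A ∪ S) x * marg X (fun y => f y * g y) (B ∪ S) x := by
  classical
  let mix : (∀ v, X v) → (∀ v, X v) → ∀ v, X v := fun y z v => if v ∈ U then y v else z v
  have mixU : ∀ {y z v}, v ∈ U → mix y z v = y v := fun h => if_pos h
  have mixU' : ∀ {y z v}, v ∉ U → mix y z v = z v := fun h => if_neg h
  have hinv : Function.Involutive
      fun w : (∀ v, X v) × (∀ v, X v) => (mix w.1 w.2, mix w.2 w.1) := by
    rintro ⟨y, z⟩
    refine Prod.ext (funext fun v => ?_) (funext fun v => ?_) <;>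
      by_cases hv : v ∈ U <;> simp [mix, hv]
  unfold marg
  rw [Fintype.sum_mul_sum, Fintype.sum_mul_sum, ← Fintype.sum_prod_type', ← Fintype.sum_prod_type']
  refine Fintype.sum_equiv hinv.toPerm _ _ ?_
  rintro ⟨y, z⟩
  have hind : ((∀ v ∈ A ∪ B ∪ S, y v = x v) ∧ ∀ v ∈ S, z v = x v) ↔
      (∀ v ∈ A ∪ S, mix y z v = x v) ∧ ∀ v ∈ B ∪ S, mix z y v = x v := by
    constructor
    · rintro ⟨h1, h2⟩
      refine ⟨fun v hv => ?_, fun v hv => ?_⟩ <;> by_cases hvS : v ∈ S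
      · by_cases hU : v ∈ U
        · rw [mixU hU, h1 v (by simp [hvS])]
        · rw [mixU' hU, h2 v hvS]
      · have hvA : v ∈ A := by simpa [hvS] using hv
        rw [mixU (hA v hvA hvS), h1 v (by simp [hvA])]
      · by_cases hU : v ∈ U
        · rw [mixU hU, h2 v hvS]
        · rw [mixU' hU, h1 v (by simp [hvS])]
      · have hvB : v ∈ B := by simpa [hvS] using hv
        rw [mixU' (hB v hvB hvS), h1 v (by simp [hvB])]
    · rintro ⟨h1, h2⟩
      have hyS : ∀ v ∈ S, y v = x v := fun v hv => by
        by_cases hU : v ∈ U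
        · rw [← h1 v (by simp [hv]), mixU hU]
        · rw [← h2 v (by simp [hv]), mixU' hU]
      have hzS : ∀ v ∈ S, z v = x v := fun v hv => by
        by_cases hU : v ∈ U
        · rw [← h2 v (by simp [hv]), mixU hU]
        · rw [← h1 v (by simp [hv]), mixU' hU]
      refine ⟨fun v hv => ?_, hzS⟩
      by_cases hvS : v ∈ S
      · exact hyS v hvS
      · have hv' : v ∈ A ∨ v ∈ B := by simpa [hvS] using hv
        rcases hv' with hv' | hv'
        · rw [← h1 v (by simp [hv']), mixU (hA v hv' hvS)]
        · rw [← h2 v (by simp [hv']), mixU' (hB v hv' hvS)]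
  refine ite_zero_mul_ite_zero_congr hind fun hc => ?_
  have hyz : ∀ v ∈ S, y v = z v := fun v hv => 
    (hc.1 v (by simp [hv])).trans (hc.2 v hv).symm
  have h1 : f (mix y z) = f y := hf _ _ fun v hv => by
    by_cases hU : v ∈ U
    · exact mixU hU
    · rw [mixU' hU, hyz v (hv.resolve_left hU)]
  have h2 : f (mix z y) = f z := hf _ _ fun v hv => by
    by_cases hU : v ∈ U
    · exact mixU hU
    · rw [mixU' hU, hyz v (hv.resolve_left hU)]
  have h3 : g (mix y z) = g z := hg _ _ fun v hv => mixU' hv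
  have h4 : g (mix z y) = g y := hg _ _ fun v hv => mixU' hv
  change _ = f (mix y z) * g (mix y z) * (f (mix z y) * g (mix z y))
  rw [h1, h2, h3, h4]
  ring

/-- d-separation implies conditional independence for factorizing functions. -/
theorem Factorizes.marg_mul_marg {E : V → V → Prop} (hE : IsDAG E)
    {p : (∀ v, X v) → ℝ} (hp : Factorizes X E p) (hX : ∀ v, 0 < Fintype.card (X v))
    {A B S : Finset V} (hd : DSep E (A : Set V) B S) (x : ∀ v, X v) :
    marg X p (A ∪ B ∪ S) x * marg X p S x = marg X p (A ∪ S) x * marg X p (B ∪ S) x := by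
  classical
  obtain ⟨k, hk, hpk⟩ := hp
  obtain rfl : p = fun x => ∏ s, k s (x s) x := funext hpk
  rw [dSep_iff_forall_sLinked hE] at hd
  let H : Finset V := univ.filter fun v => ∃ t ∈ A ∪ B ∪ S, Relation.ReflTransGen E v t
  have hH : ∀ s ∈ H, ∀ t, E t s → t ∈ H := by
    intro s hs t ht
    obtain ⟨u, hu, hsu⟩ := (mem_filter.1 hs).2
    exact mem_filter.2 ⟨mem_univ _, u, hu, .head ht hsu⟩
  have hABS : A ∪ B ∪ S ⊆ H := fun v hv => mem_filter.2 ⟨mem_univ _, v, hv, .refl⟩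
  let U : Set V := {v | SLinked E (S : Set V) A v}
  have hdesc : ∀ v ∈ H, ∃ t ∈ A ∪ B ∪ S, SDesc E (S : Set V) v t := by
    intro v hv
    obtain ⟨t, ht, hvt⟩ := (mem_filter.1 hv).2
    induction hvt using Relation.ReflTransGen.head_induction_on with
    | refl => exact ⟨t, ht, .refl⟩
    | @head u w huw hwt ih =>
      by_cases hu : u ∈ S
      · exact ⟨u, by simp [hu], .refl⟩
      · obtain ⟨t', ht', h⟩ := ih (mem_filter.2 ⟨mem_univ _, t, ht, hwt⟩)
        exact ⟨t', ht', .head ⟨hu, huw⟩ h⟩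
  have hfam : ∀ s ∈ H, ∀ v v', v ∉ S → v' ∉ S → SDesc E (S : Set V) v s →
      SDesc E (S : Set V) v' s → v ∈ U → v' ∈ U := by
    intro s hs v v' hvS hv'S hv hv' hU
    obtain ⟨t, ht, hst⟩ := hdesc s hs
    by_cases htS : t ∈ S
    · exact .link hU (hv.trans hst) htS (hv'.trans hst) hv'S
    · have ht' : t ∈ A ∨ t ∈ B := by simpa [htS] using ht
      rcases ht' with h | h
      · exact .base h htS (hv'.trans hst)
      · exact absurd (hv.trans hst) (hd v hU t h htS)
  let T : Finset V := H.filter fun s => ∃ v, v ∉ S ∧ (v = s ∨ E v s) ∧ v ∈ U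
  have hsd : ∀ v s, v ∉ S → (v = s ∨ E v s) → SDesc E (S : Set V) v s := by
    rintro v s hv (rfl | h)
    · exact .refl
    · exact .single ⟨hv, h⟩
  have hf : ∀ y z : ∀ v, X v, (∀ v, v ∈ U ∨ v ∈ S → y v = z v) →
      ∏ s ∈ T, k s (y s) y = ∏ s ∈ T, k s (z s) z := by
    intro y z hyz
    refine prod_congr rfl fun s hs => ?_
    obtain ⟨hsH, v, hvS, hvs, hvU⟩ := mem_filter.1 hs
    have h : ∀ u, (u = s ∨ E u s) → y u = z u := by
      intro u hu
      by_cases huS : u ∈ S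
      · exact hyz u (Or.inr huS)
      · exact hyz u (Or.inl (hfam s hsH v u hvS huS (hsd _ _ hvS hvs) (hsd _ _ huS hu) hvU))
    exact (hk s).congr (h s (Or.inl rfl)) fun t ht => h t (Or.inr ht)
  have hg : ∀ y z : ∀ v, X v, (∀ v, v ∉ U → y v = z v) →
      ∏ s ∈ H \ T, k s (y s) y = ∏ s ∈ H \ T, k s (z s) z := by
    intro y z hyz
    refine prod_congr rfl fun s hs => ?_
    rw [mem_sdiff] at hs
    have h : ∀ u, (u = s ∨ E u s) → y u = z u := fun u hu => hyz u fun hU =>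
      hs.2 (mem_filter.2 ⟨hs.1, u, hU.notMem, hu, hU⟩)
    exact (hk s).congr (h s (Or.inl rfl)) fun t ht => h t (Or.inr ht)
  have hsplit := marg_mul_marg_of_split (U := U) (A := A) (B := B) (S := S)
    (fun v hv hvS => .base hv hvS .refl) (fun v hv hvS hU => hd v hU v hv hvS .refl) hf hg x
  have hprod : (fun y : ∀ v, X v => (∏ s ∈ T, k s (y s) y) * ∏ s ∈ H \ T, k s (y s) y) =
      fun y => ∏ s ∈ H, k s (y s) y := by
    funext y
    rw [mul_comm, prod_sdiff (filter_subset _ _)]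
  rw [hprod, marg_prod_closed hE hk hH hABS,
    marg_prod_closed hE hk hH (subset_union_right.trans hABS),
    marg_prod_closed hE hk hH ((union_subset_union_left subset_union_left).trans hABS),
    marg_prod_closed hE hk hH ((union_subset_union_left subset_union_right).trans hABS)] at hsplit
  have hc : (∏ v ∈ univ \ H, (Fintype.card (X v) : ℝ)) ≠ 0 :=
    prod_ne_zero_iff.2 fun v _ => Nat.cast_ne_zero.2 (hX v).ne'
  refine mul_left_cancel₀ (mul_ne_zero hc hc) ?_
  linear_combination hsplit

/-- A pmf satisfying the ordered local Markov property of a DAG factorizes over it. -/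
lemma factorizes_of_local_markov {E : V → V → Prop} (hE : IsDAG E) {p : (∀ v, X v) → ℝ}
    (hp : IsPMF X p) (hX : ∀ v, 0 < Fintype.card (X v))
    (h : ∀ (C S : Finset V) (s : V), (∀ v ∈ C, ∀ t, E t v → t ∈ C) → s ∉ C →
      (S : Set V) = paG E s → ∀ x, marg X p ({s} ∪ C ∪ S) x * marg X p S x =
        marg X p ({s} ∪ S) x * marg X p (C ∪ S) x) : Factorizes X E p := by
  classical
  let pa : V → Finset V := fun s => univ.filter fun t => E t s
  have hpa : ∀ {s t}, t ∈ pa s ↔ E t s := by simp [pa]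
  have hspa : ∀ s, s ∉ pa s := fun s hs => hE s (.single (hpa.1 hs))
  let k : ∀ s, X s → (∀ v, X v) → ℝ := fun s a x =>
    if marg X p (pa s) x = 0 then (Fintype.card (X s) : ℝ)⁻¹
    else marg X p (insert s (pa s)) (Function.update x s a) / marg X p (pa s) x
  refine ⟨k, fun s => ⟨fun a x => ?_, fun a x y hxy => ?_, fun x => ?_⟩, fun x => ?_⟩
  · simp only [k]
    split_ifs
    · positivity
    · exact div_nonneg (marg_nonneg hp.1 _ _) (marg_nonneg hp.1 _ _)
  · have h1 : marg X p (pa s) x = marg X p (pa s) y := marg_congr p fun v hv => hxy v (hpa.1 hv)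
    have h2 : marg X p (insert s (pa s)) (Function.update x s a) =
        marg X p (insert s (pa s)) (Function.update y s a) := by
      refine marg_congr p fun v hv => ?_
      by_cases hvs : v = s
      · subst hvs; simp
      · rw [Function.update_of_ne hvs, Function.update_of_ne hvs]
        exact hxy v (hpa.1 ((mem_insert.1 hv).resolve_left hvs))
    simp only [k, h1, h2]
  · simp only [k]
    split_ifs with h0
    · simp [(hX s).ne']
    · rw [← sum_div, sum_marg_insert p (hspa s), div_self h0]
  · have key := hE.closed_induction
      (P := fun C => marg X p C x = ∏ s ∈ C, k s (x s) x) (H := ∅) (by simp)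
      (by simpa [marg] using hp.2) fun C _ hcl s hs hps ih => ?_
    · rw [← key]
      have : ∀ y, (∀ v ∈ (univ : Finset V), y v = x v) ↔ y = x := fun y =>
        ⟨fun h => funext fun v => h v (mem_univ v), fun h v _ => h ▸ rfl⟩
      simp [marg, ← funext_iff]
    · rw [prod_insert hs, ← ih]
      have hsub : pa s ⊆ C := fun t ht => hps t (hpa.1 ht)
      have hm := h C (pa s) s hcl hs (by ext t; simp [hpa, paG]) x
      rw [union_assoc, union_eq_left.2 hsub, ← insert_eq, ← insert_eq] at hm
      simp only [k, Function.update_eq_self]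
      split_ifs with h0
      · have h1 : marg X p C x = 0 :=
          le_antisymm (h0 ▸ marg_anti hp.1 hsub x) (marg_nonneg hp.1 _ _)
        rw [h1, mul_zero]
        exact le_antisymm (h1 ▸ marg_anti hp.1 (subset_insert s C) x) (marg_nonneg hp.1 _ _)
      · rw [div_mul_eq_mul_div, eq_div_iff h0, hm]

end Factorization

section Completeness

variable {V : Type*}

/-- `c 0, …, c k` are nodes outside `S` such that `c 0` is an ancestor of `a`, `c k` is one of
`b`, and consecutive ones have a common descendant in `S`, all along `S`-avoiding paths. -/
structure AncestorChain (E : V → V → Prop) (S : Set V) (a b : V) (c : ℕ → V) (k : ℕ) : Prop where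
  left : SDesc E S (c 0) a
  right : SDesc E S (c k) b
  notMem : ∀ i ≤ k, c i ∉ S
  link : ∀ i < k, ∃ s ∈ S, SDesc E S (c i) s ∧ SDesc E S (c (i + 1)) s

lemma SLinked.exists_ancestorChain {E : V → V → Prop} {S A : Set V} {r : V}
    (h : SLinked E S A r) :
    ∃ a ∈ A, a ∉ S ∧ ∃ c k, c k = r ∧ AncestorChain E S a r c k := by
  induction h with
  | @base r a ha haS hd =>
    have hr : r ∉ S := (SLinked.base ha haS hd).notMem
    exact ⟨a, ha, haS, fun _ => r, 0, rfl, hd, .refl, fun _ _ => hr, by simp⟩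
  | @link r r' s _ hd hs hd' hr' ih =>
    obtain ⟨a, ha, haS, c, k, hck, h⟩ := ih
    refine ⟨a, ha, haS, fun m => if m ≤ k then c m else r', k + 1, by simp, ?_, ?_, ?_, ?_⟩
    · simpa using h.left
    · simp only [show ¬ k + 1 ≤ k by omega, if_false]
      exact .refl
    · intro i hi
      by_cases hik : i ≤ k
      · simpa [hik] using h.notMem i hik
      · simpa [hik] using hr'
    · intro i hi
      rcases Nat.lt_succ_iff_lt_or_eq.1 hi with hi | rfl
      · simpa [hi.le, Nat.succ_le_iff.2 hi] using h.link i hi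
      · exact ⟨s, hs, by simpa [hck] using hd, by simpa using hd'⟩

variable {E : V → V → Prop} {S : Set V} {a b : V} {c : ℕ → V} {k : ℕ}

/-- An ancestor chain of minimal length. -/
structure MinChain (E : V → V → Prop) (S : Set V) (a b : V) (c : ℕ → V) (k : ℕ) : Prop
    extends AncestorChain E S a b c k where
  min : ∀ c' k', AncestorChain E S a b c' k' → k ≤ k'

lemma AncestorChain.exists_minChain (h : AncestorChain E S a b c k) :
    ∃ c k, MinChain E S a b c k := by
  classical
  have hex : ∃ k c, AncestorChain E S a b c k := ⟨k, c, h⟩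
  obtain ⟨c', hc'⟩ := Nat.find_spec hex
  exact ⟨c', _, hc', fun c'' k'' h'' => Nat.find_min' hex ⟨c'', h''⟩⟩

namespace MinChain

lemma eq_zero_of_left (h : MinChain E S a b c k) {i : ℕ} (hi : i ≤ k)
    (hd : SDesc E S (c i) a) : i = 0 := by
  have := h.min (fun m => c (m + i)) (k - i) ⟨by simpa using hd, ?_, ?_, ?_⟩
  · omega
  · simpa [Nat.sub_add_cancel hi] using h.right
  · exact fun j hj => h.notMem _ (by omega)
  · intro j hj
    have := h.link (j + i) (by omega)
    rwa [show j + i + 1 = j + 1 + i by omega] at this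

lemma eq_of_right (h : MinChain E S a b c k) {i : ℕ} (hi : i ≤ k)
    (hd : SDesc E S (c i) b) : i = k := by
  have := h.min c i ⟨h.left, hd, fun j hj => h.notMem j (by omega),
    fun j hj => h.link j (by omega)⟩
  omega

lemma le_succ_of_mem (h : MinChain E S a b c k) {i j : ℕ} (hj : j ≤ k) {s : V}
    (hs : s ∈ S) (h1 : SDesc E S (c i) s) (h2 : SDesc E S (c j) s) : j ≤ i + 1 := by
  by_contra hlt
  obtain ⟨d, rfl⟩ : ∃ d, j = i + 1 + (d + 1) := ⟨j - i - 2, by omega⟩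
  have := h.min (fun m => if m ≤ i then c m else c (m + (d + 1))) (k - (d + 1))
    ⟨by simpa using h.left, ?_, ?_, ?_⟩
  · omega
  · simp only [show ¬ k - (d + 1) ≤ i by omega, if_false]
    rw [Nat.sub_add_cancel (by omega)]
    exact h.right
  · intro m hm
    split_ifs
    · exact h.notMem _ (by omega)
    · exact h.notMem _ (by omega)
  · intro m hm
    rcases lt_trichotomy m i with hmi | rfl | hmi
    · simpa [hmi.le, Nat.succ_le_iff.2 hmi] using h.link m (by omega)
    · exact ⟨s, hs, by simpa using h1, by simpa using h2⟩
    · have := h.link (m + (d + 1)) (by omega)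
      rw [show m + (d + 1) + 1 = m + 1 + (d + 1) by omega] at this
      simpa [show ¬ m ≤ i by omega, show ¬ m + 1 ≤ i by omega] using this

end MinChain

/-- `v` has an `S`-avoiding path to `S`, to `a` or to `b`. -/
def Relevant (E : V → V → Prop) (S : Set V) (a b v : V) : Prop :=
  ∃ x, (x ∈ S ∨ x = a ∨ x = b) ∧ SDesc E S v x

/-- `v` is a descendant of the `i`-th node of the chain. -/
def Below (E : V → V → Prop) (S : Set V) (c : ℕ → V) (k : ℕ) (v : V) (i : ℕ) : Prop :=
  i ≤ k ∧ SDesc E S (c i) v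

/-- `v` lies outside `S` and descends from the `i`-th node of the chain only. -/
def Carrier (E : V → V → Prop) (S : Set V) (a b : V) (c : ℕ → V) (k : ℕ) (v : V) (i : ℕ) : Prop :=
  v ∉ S ∧ Relevant E S a b v ∧ Below E S c k v i ∧ ∀ j, Below E S c k v j → j = i

/-- `v` descends from two consecutive nodes of the chain. -/
def Comparator (E : V → V → Prop) (S : Set V) (a b : V) (c : ℕ → V) (k : ℕ) (v : V) : Prop :=
  Relevant E S a b v ∧ ∃ i, Below E S c k v i ∧ Below E S c k v (i + 1)

lemma Relevant.of_edge {q v : V} (hv : Relevant E S a b v) (hq : q ∉ S) (h : E q v) :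
    Relevant E S a b q := by
  obtain ⟨x, hx, hd⟩ := hv
  exact ⟨x, hx, .head ⟨hq, h⟩ hd⟩

lemma Below.of_edge {q v : V} {i : ℕ} (hq : Below E S c k q i) (hqS : q ∉ S) (h : E q v) :
    Below E S c k v i :=
  ⟨hq.1, hq.2.tail ⟨hqS, h⟩⟩

lemma Below.exists_parent {v : V} {i : ℕ} (hv : Below E S c k v i) (hne : v ≠ c i) :
    ∃ q, E q v ∧ q ∉ S ∧ Below E S c k q i := by
  rcases Relation.ReflTransGen.cases_tail hv.2 with h | ⟨q, h1, h2, h3⟩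
  · exact absurd h hne
  · exact ⟨q, h3, h2, hv.1, h1⟩

lemma Carrier.not_comparator {v : V} {i : ℕ} (hv : Carrier E S a b c k v i) :
    ¬ Comparator E S a b c k v := by
  rintro ⟨-, j, h1, h2⟩
  have h3 := hv.2.2.2 _ h1
  have h4 := hv.2.2.2 _ h2
  omega

lemma MinChain.below_le (h : MinChain E S a b c k) {v : V} {i j : ℕ}
    (hv : Relevant E S a b v) (hi : Below E S c k v i) (hj : Below E S c k v j) : j ≤ i + 1 := by
  obtain ⟨x, hx, hd⟩ := hv
  rcases hx with hx | rfl | rfl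
  · exact h.le_succ_of_mem hj.1 hx (hi.2.trans hd) (hj.2.trans hd)
  · have := h.eq_zero_of_left hj.1 (hj.2.trans hd)
    omega
  · have h1 := h.eq_of_right hj.1 (hj.2.trans hd)
    have h2 := h.eq_of_right hi.1 (hi.2.trans hd)
    omega

lemma MinChain.below_node (h : MinChain E S a b c k) {i j : ℕ} (hi : i ≤ k)
    (hj : Below E S c k (c i) j) : j = i := by
  have h1 : i ≤ j := by
    rcases hi.eq_or_lt with rfl | hi
    · rw [h.eq_of_right hj.1 (hj.2.trans h.right)]
    · obtain ⟨s, hs, h1, h2⟩ := h.link i hi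
      have := h.le_succ_of_mem (i := j) hi hs (hj.2.trans h1) h2
      omega
  have h2 : j ≤ i := by
    rcases Nat.eq_zero_or_pos i with rfl | hpos
    · rw [h.eq_zero_of_left hj.1 (hj.2.trans h.left)]
    · obtain ⟨i, rfl⟩ : ∃ i', i = i' + 1 := ⟨i - 1, by omega⟩
      obtain ⟨s, hs, h1, h2⟩ := h.link i (by omega)
      exact h.le_succ_of_mem hj.1 hs h1 (hj.2.trans h2)
  omega

/-- A system of deterministic binary gates at some of the nodes, reading only the parents, under
which `a` and `b` are forced to agree once all nodes of `S` are off. -/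
lemma MinChain.exists_gates (hE : IsDAG E) [Finite V] (h : MinChain E S a b c k)
    (haS : a ∉ S) (hbS : b ∉ S) :
    ∃ (con : V → Prop) (f : V → (V → Prop) → Prop),
      (∀ v y y', (∀ t, E t v → (y t ↔ y' t)) → (f v y ↔ f v y')) ∧
      (∀ v, ¬ f v fun _ => False) ∧
      (∃ y, (∀ v, con v → (y v ↔ f v y)) ∧ y a ∧ ∀ v ∈ S, ¬ y v) ∧
      ∀ y, (∀ v, con v → (y v ↔ f v y)) → (∀ v ∈ S, ¬ y v) → (y a ↔ y b) := by
  have wf : WellFounded E :=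
    have : IsTrans V (Relation.TransGen E) := ⟨fun _ _ _ => Relation.TransGen.trans⟩
    have : Std.Irrefl (Relation.TransGen E) := ⟨hE⟩
    Subrelation.wf (fun h => Relation.TransGen.single h)
      (Finite.wellFounded_of_trans_of_irrefl (Relation.TransGen E))
  let W : V → ℕ → Prop := Carrier E S a b c k
  let Z : V → Prop := Comparator E S a b c k
  let f : V → (V → Prop) → Prop := fun v y =>
    (Z v ∧ ((∃ q, E q v ∧ q ∉ S ∧ Z q ∧ y q) ∨
      ∃ q q', E q v ∧ E q' v ∧ (∃ i, W q i) ∧ (∃ i, W q' i) ∧ y q ∧ ¬ y q')) ∨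
    (¬ Z v ∧ ∃ q, E q v ∧ (∃ i, W q i) ∧ y q)
  have hWpar : ∀ {v q i}, W v i → E q v → q ∉ S → Below E S c k q i → W q i :=
    fun hv hq hqS hi => ⟨hqS, hv.2.1.of_edge hqS hq, hi, fun j hj =>
      hv.2.2.2 j (hj.of_edge hqS hq)⟩
  have hZpar : ∀ {v q i j}, Relevant E S a b v → Below E S c k v i → Below E S c k v (i + 1) →
      E q v → q ∉ S → Below E S c k q j → (j = i ∨ j = i + 1) → W q j ∨
        (Below E S c k q i ∧ Below E S c k q (i + 1)) := by
    intro v q i j hv hi hi' hq hqS hj hji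
    by_cases hu : ∀ j', Below E S c k q j' → j' = j
    · exact Or.inl ⟨hqS, hv.of_edge hqS hq, hj, hu⟩
    · push Not at hu
      obtain ⟨j', hj', hne⟩ := hu
      have h1 := h.below_le hv hi (hj'.of_edge hqS hq)
      have h2 := h.below_le hv (hj'.of_edge hqS hq) hi'
      right
      rcases hji with rfl | rfl
      · obtain rfl : j' = j + 1 := by omega
        exact ⟨hj, hj'⟩
      · obtain rfl : j' = i := by omega
        exact ⟨hj', hj⟩
  have hWa : W a 0 := ⟨haS, ⟨a, by simp, .refl⟩, ⟨Nat.zero_le _, h.left⟩,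
    fun j hj => h.eq_zero_of_left hj.1 hj.2⟩
  have hWb : W b k := ⟨hbS, ⟨b, by simp, .refl⟩, ⟨le_rfl, h.right⟩,
    fun j hj => h.eq_of_right hj.1 hj.2⟩
  refine ⟨fun v => Z v ∨ ∃ i, W v i ∧ v ≠ c i, f, ?_, ?_, ⟨fun v => ∃ i, W v i, ?_, ⟨0, hWa⟩, ?_⟩,
    ?_⟩
  · intro v y y' hy
    refine or_congr (and_congr_right fun _ => or_congr (exists_congr fun q => ?_)
      (exists₂_congr fun q q' => ?_)) (and_congr_right fun _ => exists_congr fun q => ?_)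
    · exact and_congr_right fun hq => by rw [hy q hq]
    · exact and_congr_right fun hq => and_congr_right fun hq' => by rw [hy q hq, hy q' hq']
    · exact and_congr_right fun hq => by rw [hy q hq]
  · simp [f]
  · rintro v (hZ | ⟨i, hW, hne⟩)
    · refine iff_of_false (fun ⟨i, hi⟩ => hi.not_comparator hZ) ?_
      rintro (⟨-, ⟨q, -, -, hqZ, i, hi⟩ | ⟨q, q', -, -, -, h1, -, h2⟩⟩ | ⟨h1, -⟩)
      · exact hi.not_comparator hqZ
      · exact h2 h1
      · exact h1 hZ
    · refine iff_of_true ⟨i, hW⟩ (Or.inr ⟨hW.not_comparator, ?_⟩)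
      obtain ⟨q, hq, hqS, hi⟩ := hW.2.2.1.exists_parent hne
      have := hWpar hW hq hqS hi
      exact ⟨q, hq, ⟨i, this⟩, i, this⟩
  · rintro v hv ⟨i, hi⟩
    exact hi.1 hv
  · intro y hy hyS
    have hWy : ∀ v i, W v i → (y v ↔ y (c i)) := by
      intro v
      induction v using wf.induction with
      | _ v ih =>
        intro i hW
        by_cases hne : v = c i
        · rw [hne]
        · rw [hy v (Or.inr ⟨i, hW, hne⟩)]
          constructor
          · rintro (⟨hZ, -⟩ | ⟨-, q, hq, ⟨j, hj⟩, hyq⟩)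
            · exact absurd hZ hW.not_comparator
            · obtain rfl : j = i := hW.2.2.2 _ (hj.2.2.1.of_edge hj.1 hq)
              exact (ih q hq j hj).1 hyq
          · intro hyi
            obtain ⟨q, hq, hqS, hi⟩ := hW.2.2.1.exists_parent hne
            have hWq := hWpar hW hq hqS hi
            exact Or.inr ⟨hW.not_comparator, q, hq, ⟨i, hWq⟩, (ih q hq i hWq).2 hyi⟩
    have hZy : ∀ v i, Relevant E S a b v → Below E S c k v i → Below E S c k v (i + 1) →
        ¬ (y (c i) ↔ y (c (i + 1))) → y v := by
      intro v
      induction v using wf.induction with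
      | _ v ih =>
        intro i hv hi hi' hdiff
        have hZ : Z v := ⟨hv, i, hi, hi'⟩
        rw [hy v (Or.inl hZ)]
        refine Or.inl ⟨hZ, ?_⟩
        obtain ⟨q, hq, hqS, hqi⟩ := hi.exists_parent fun hh => by
          have := h.below_node hi.1 (hh ▸ hi'); omega
        obtain ⟨q', hq', hqS', hqi'⟩ := hi'.exists_parent fun hh => by
          have := h.below_node hi'.1 (hh ▸ hi); omega
        rcases hZpar hv hi hi' hq hqS hqi (Or.inl rfl) with hWq | ⟨h1, h2⟩
        · rcases hZpar hv hi hi' hq' hqS' hqi' (Or.inr rfl) with hWq' | ⟨h1, h2⟩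
          · right
            have h1 := hWy q _ hWq
            have h2 := hWy q' _ hWq'
            by_cases hyq : y q
            · exact ⟨q, q', hq, hq', ⟨_, hWq⟩, ⟨_, hWq'⟩, hyq, by tauto⟩
            · exact ⟨q', q, hq', hq, ⟨_, hWq'⟩, ⟨_, hWq⟩, by tauto, hyq⟩
          · have hvq := hv.of_edge hqS' hq'
            exact Or.inl ⟨q', hq', hqS', ⟨hvq, i, h1, h2⟩, ih q' hq' i hvq h1 h2 hdiff⟩
        · have hvq := hv.of_edge hqS hq
          exact Or.inl ⟨q, hq, hqS, ⟨hvq, i, h1, h2⟩, ih q hq i hvq h1 h2 hdiff⟩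
    have hall : ∀ i ≤ k, (y (c 0) ↔ y (c i)) := by
      intro i
      induction i with
      | zero => exact fun _ => Iff.rfl
      | succ i ih =>
        intro hi
        refine (ih (by omega)).trans ?_
        obtain ⟨s, hs, h1, h2⟩ := h.link i hi
        by_contra hdiff
        exact hyS s hs (hZy s i ⟨s, Or.inl hs, .refl⟩ ⟨by omega, h1⟩ ⟨hi, h2⟩ hdiff)
    rw [hWy a 0 hWa, hWy b k hWb]
    exact hall k le_rfl

/-- If every pmf factorizing over one DAG factorizes over another, then every d-separation in the
latter holds in the former. -/
lemma dSep_of_forall_factorizes [Fintype V] [DecidableEq V] {X : V → Type*} [∀ v, Fintype (X v)]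
    (h2 : ∀ v, 1 < Fintype.card (X v)) {E E' : V → V → Prop} (hE : IsDAG E) (hE' : IsDAG E')
    (hP : ∀ p : (∀ v, X v) → ℝ, IsPMF X p → Factorizes X E p → Factorizes X E' p)
    {A B S : Set V} (hd : DSep E' A B S) : DSep E A B S := by
  classical
  rw [dSep_iff_forall_sLinked hE]
  intro r hr b hb hbS hrb
  obtain ⟨a, ha, haS, c, k, rfl, hch⟩ := hr.exists_ancestorChain
  obtain ⟨c, k, hmin⟩ := AncestorChain.exists_minChain
    (show AncestorChain E S a b c k from ⟨hch.left, hrb, hch.notMem, hch.link⟩)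
  obtain ⟨con, f, hdep, hf0, ⟨y₁, hy₁, hy₁a, hy₁S⟩, hforce⟩ := hmin.exists_gates hE haS hbS
  have hd' : DSep E' {a} {b} S := fun l a' b' h1 h2 h3 h4 h5 =>
    hd l a' b' h1 h2 h3 (Set.mem_singleton_iff.1 h4 ▸ ha) (Set.mem_singleton_iff.1 h5 ▸ hb)
  have hab : a ≠ b := by
    rintro rfl
    exact (dSep_iff_forall_sLinked hE' _ _ _).1 hd' a (.base rfl haS .refl) a rfl haS .refl
  have : ∀ v, Nonempty (X v) := fun v => Fintype.card_pos_iff.1 (by have := h2 v; omega)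
  choose e₀ e₁ he using fun v => Fintype.exists_pair_of_one_lt_card (h2 v)
  let dec : (∀ v, X v) → V → Prop := fun x v => x v = e₁ v
  let enc : ∀ v, Prop → X v := fun v P => if P then e₁ v else e₀ v
  have hdec : ∀ v P, enc v P = e₁ v ↔ P := fun v P => by
    by_cases h : P <;> simp [enc, h, he v]
  let K : ∀ v, X v → (∀ v, X v) → ℝ := fun v s x =>
    if con v then (if s = enc v (f v (dec x)) then 1 else 0) else (Fintype.card (X v) : ℝ)⁻¹
  have hcard : ∀ v, (0 : ℝ) < Fintype.card (X v) := fun v => by exact_mod_cast Fintype.card_pos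
  have hK0 : ∀ v s x, 0 ≤ K v s x := fun v s x => by
    simp only [K]
    split_ifs
    exacts [zero_le_one, le_rfl, (inv_pos.2 (hcard v)).le]
  have hK : ∀ v, IsKernel X E v (K v) := by
    refine fun v => ⟨hK0 v, fun s x y hxy => ?_, fun x => ?_⟩
    · have : f v (dec x) = f v (dec y) :=
        propext (hdep v _ _ fun t ht => by simp only [dec, hxy t ht])
      simp only [K, this]
    · by_cases hv : con v
      · simp [K, hv]
      · simp [K, hv, (hcard v).ne']
  let p : (∀ v, X v) → ℝ := fun x => ∏ v, K v (x v) x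
  have hp : IsPMF X p := isPMF_prod_kernel hE hK
  have hp_pos : ∀ y : V → Prop, (∀ v, con v → (y v ↔ f v y)) → 0 < p fun v => enc v (y v) := by
    intro y hy
    refine Finset.prod_pos fun v _ => ?_
    have hy' : dec (fun v => enc v (y v)) = y := funext fun t => propext (hdec t _)
    by_cases hv : con v
    · simp [K, hv, hy', ← hy v hv]
    · simpa [K, hv] using Fintype.card_pos
  have hp_con : ∀ x, p x ≠ 0 → ∀ v, con v → (dec x v ↔ f v (dec x)) := by
    intro x hx v hv
    have h1 : K v (x v) x ≠ 0 := Finset.prod_ne_zero_iff.1 hx v (Finset.mem_univ v)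
    have h2 : x v = enc v (f v (dec x)) := by
      by_contra hne
      exact h1 (by simp [K, hv, hne])
    change x v = e₁ v ↔ _
    rw [h2, hdec]
  have h₁ := hp_pos y₁ hy₁
  have h₀ := hp_pos (fun _ => False) fun v _ => iff_of_false id (hf0 v)
  let z : ∀ v, X v := fun v => enc v (v = a)
  have hzS : ∀ v ∈ S, z v = e₀ v := fun v hv => if_neg fun (h : v = a) => haS (h ▸ hv)
  have hmul := (hP p hp ⟨K, hK, fun _ => rfl⟩).marg_mul_marg hE' (fun v => Fintype.card_pos)
    (A := {a}) (B := {b}) (S := S.toFinset) (by simpa using hd') z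
  have hza : 0 < marg X p ({a} ∪ S.toFinset) z := marg_pos hp.1 h₁ fun v hv => by
    rcases Finset.mem_union.1 hv with hv | hv
    · obtain rfl := Finset.mem_singleton.1 hv
      simp [z, hy₁a]
    · rw [Set.mem_toFinset] at hv
      exact (if_neg (hy₁S v hv)).trans (hzS v hv).symm
  have hzb : 0 < marg X p ({b} ∪ S.toFinset) z := marg_pos hp.1 h₀ fun v hv => by
    rcases Finset.mem_union.1 hv with hv | hv
    · obtain rfl := Finset.mem_singleton.1 hv
      simp [z, hab.symm]
    · rw [Set.mem_toFinset] at hv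
      exact (if_neg id).trans (hzS v hv).symm
  obtain ⟨y, hy, hyz⟩ := exists_of_marg_ne_zero
    (left_ne_zero_of_mul (hmul.trans_ne (mul_pos hza hzb).ne'))
  have hya : dec y a := (hyz a (by simp)).trans ((hdec a _).2 rfl)
  have hyb : dec y b := (hforce (dec y) (hp_con y hy) fun v hv h =>
    he v ((hzS v hv).symm.trans ((hyz v (by simp [hv])).symm.trans h))).1 hya
  exact hab ((hdec b _).1 ((hyz b (by simp)).symm.trans hyb)).symm

end Completeness

/-- `P^{G'} ⊇ P^G` iff every d-separation in `G'` is a d-separation in `G`. -/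
theorem stmt6 {V : Type*} [Fintype V] [DecidableEq V] [Nonempty V]
    (X : V → Type*) [∀ v, Fintype (X v)] (h2 : ∀ v, 1 < Fintype.card (X v))
    (E E' : V → V → Prop) (hE : IsDAG E) (hE' : IsDAG E') :
    (∀ p : (∀ v, X v) → ℝ, IsPMF X p → Factorizes X E p → Factorizes X E' p) ↔
    (∀ A B S : Set V, DSep E' A B S → DSep E A B S) := by
  classical
  have hX : ∀ v, 0 < Fintype.card (X v) := fun v => by have := h2 v; omega
  refine ⟨fun hP A B S hd => dSep_of_forall_factorizes h2 hE hE' hP hd, fun h p hp hf => ?_⟩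
  refine factorizes_of_local_markov hE' hp hX fun C S s hC hs hS x => ?_
  refine hf.marg_mul_marg hE hX (h _ _ _ ?_) x
  rw [hS, Finset.coe_singleton]
  exact dSep_parents hE' (by simpa using hC) (by simpa using hs)
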